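/- The maximum matching size of a finite simple graph G on n vertices equals the minimum over all vertex sets S ⊆ V of (1/2)(n − (odd(G \ S) − |S|)). -/

import Mathlib

open SimpleGraph

/-- Number of odd connected components of the graph induced on the complement of `S`. -/
noncomputable def oddComp {V : Type*} (G : SimpleGraph V) (S : Set V) : ℕ :=
  Nat.card {c : (G.induce Sᶜ).ConnectedComponent // Odd (Nat.card c.supp)}

/-- A 1-planar drawing of a graph: vertices are points in the plane, edges are
simple curves between their endpoints avoiding other vertices, and every edge
contains at most one crossing point with other edges. -/
structure OnePlanarDrawing {V : Type*} (G : SimpleGraph V) where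
  vert : V → ℝ × ℝ
  vert_inj : Function.Injective vert
  curve : G.edgeSet → ℝ → ℝ × ℝ
  curve_cont : ∀ e, ContinuousOn (curve e) (Set.Icc 0 1)
  curve_inj : ∀ e, Set.InjOn (curve e) (Set.Icc 0 1)
  curve_ends : ∀ (e : G.edgeSet) (u v : V), (e : Sym2 V) = s(u, v) →
    ({curve e 0, curve e 1} : Set (ℝ × ℝ)) = {vert u, vert v}
  interior_avoid : ∀ (e : G.edgeSet), ∀ t ∈ Set.Ioo (0:ℝ) 1, ∀ v, curve e t ≠ vert v
  one_cross : ∀ e : G.edgeSet,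
    Set.Subsingleton {p : ℝ × ℝ | ∃ f : G.edgeSet, f ≠ e ∧
      p ∈ curve e '' Set.Ioo (0:ℝ) 1 ∧ p ∈ curve f '' Set.Ioo (0:ℝ) 1}

/-- A graph is 1-planar if it admits a 1-planar drawing. -/
def OnePlanar {V : Type*} (G : SimpleGraph V) : Prop := Nonempty (OnePlanarDrawing G)

/-- An edge is crossed in a drawing if its interior meets the interior of another edge. -/
def OnePlanarDrawing.Crossed {V : Type*} {G : SimpleGraph V} (D : OnePlanarDrawing G)
    (e : G.edgeSet) : Prop :=
  ∃ f : G.edgeSet, f ≠ e ∧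
    (D.curve e '' Set.Ioo (0:ℝ) 1 ∩ D.curve f '' Set.Ioo (0:ℝ) 1).Nonempty

lemma SimpleGraph.Iso.ncard_oddComponents_eq {V W : Type*} {G : SimpleGraph V}
    {H : SimpleGraph W} (φ : G ≃g H) : G.oddComponents.ncard = H.oddComponents.ncard :=
  Nat.card_congr <| φ.connectedComponentEquiv.subtypeEquiv fun c ↦ by
    change Odd (Nat.card c.supp) ↔ Odd (Nat.card (φ.connectedComponentEquiv c).supp)
    rw [Nat.card_congr (ConnectedComponent.isoEquivSupp φ c)]

lemma oddComp_eq_ncard_oddComponents {V : Type*} (G : SimpleGraph V) (S : Set V) :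
    oddComp G S = (G.induce Sᶜ).oddComponents.ncard := rfl

lemma SimpleGraph.isTutteViolator_iff_lt_oddComp {V : Type*} {G : SimpleGraph V} {S : Set V} :
    G.IsTutteViolator S ↔ S.ncard < oddComp G S := by
  let φ : ((⊤ : G.Subgraph).deleteVerts S).coe ≃g G.induce Sᶜ :=
    { toEquiv := Equiv.subtypeEquivRight fun v ↦ by simp
      map_rel_iff' := by
        rintro ⟨a, ha⟩ ⟨b, hb⟩
        simp at ha hb
        simp [ha, hb] }
  rw [IsTutteViolator, φ.ncard_oddComponents_eq, oddComp_eq_ncard_oddComponents]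

lemma odd_oddComp_iff {V : Type*} [Finite V] (G : SimpleGraph V) (S : Set V) :
    Odd (oddComp G S) ↔ Odd (Sᶜ.ncard) := by
  rw [oddComp_eq_ncard_oddComponents, odd_ncard_oddComponents, Nat.card_coe_set_eq]

lemma SimpleGraph.Subgraph.IsMatching.two_mul_ncard_edgeSet {V : Type*} [Finite V]
    {G : SimpleGraph V} {M : G.Subgraph} (hM : M.IsMatching) :
    2 * M.edgeSet.ncard = M.verts.ncard := by
  classical
  cases nonempty_fintype V
  have hdeg (v : V) : M.spanningCoe.degree v = if v ∈ M.verts then 1 else 0 := by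
    rw [Subgraph.degree_spanningCoe]
    split_ifs with hv
    · exact isMatching_iff_forall_degree.1 hM v hv
    · exact M.degree_of_notMem_verts hv
  rw [← Subgraph.edgeSet_spanningCoe, ← coe_edgeFinset, Set.ncard_coe_finset,
    ← sum_degrees_eq_twice_card_edges]
  simp [hdeg, Set.ncard_eq_toFinset_card']

/-- An odd component of `G \ S` contains a vertex that a given matching of `G` either misses or
matches into `S`. -/
lemma SimpleGraph.Subgraph.IsMatching.exists_unmatched_or_adj_of_odd {V : Type*} [Finite V]
    {G : SimpleGraph V} {M : G.Subgraph} (hM : M.IsMatching) {S : Set V}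
    (c : (G.induce Sᶜ).ConnectedComponent) (hc : Odd c.supp.ncard) :
    ∃ w ∈ c.supp, ↑w ∉ M.verts ∨ ∃ v ∈ S, M.Adj w v := by
  classical
  cases nonempty_fintype V
  by_contra! h
  have hmatch : (M.induce (Subtype.val '' c.supp)).IsMatching := by
    rintro _ ⟨w, hw, rfl⟩
    obtain ⟨x, hx, huniq⟩ := hM (h w hw).1
    have hxS : x ∈ Sᶜ := fun hxS ↦ (h w hw).2 x hxS hx
    refine ⟨x, ⟨⟨w, hw, rfl⟩, ⟨⟨x, hxS⟩, ?_, rfl⟩, hx⟩, fun y hy ↦ huniq y hy.2.2⟩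
    exact (c.mem_supp_congr_adj (show (G.induce Sᶜ).Adj w ⟨x, hxS⟩ from hx.adj_sub)).1 hw
  have heven := hmatch.two_mul_ncard_edgeSet
  rw [Subgraph.induce_verts, Set.ncard_image_of_injective _ Subtype.val_injective] at heven
  exact Nat.not_even_iff_odd.2 hc (heven ▸ even_two_mul _)

lemma SimpleGraph.Subgraph.IsMatching.oddComp_add_two_mul_ncard_edgeSet_le {V : Type*} [Finite V]
    {G : SimpleGraph V} {M : G.Subgraph} (hM : M.IsMatching) (S : Set V) :
    oddComp G S + 2 * M.edgeSet.ncard ≤ Nat.card V + S.ncard := by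
  choose w hwc hw using hM.exists_unmatched_or_adj_of_odd (S := S)
  have hf (c : (G.induce Sᶜ).oddComponents) :
      ∃ v : V, (v = w c.1 c.2 ∧ v ∉ M.verts) ∨ (v ∈ S ∧ M.Adj (w c.1 c.2) v) := by
    rcases hw c.1 c.2 with h | ⟨v, hv, hadj⟩
    · exact ⟨_, .inl ⟨rfl, h⟩⟩
    · exact ⟨v, .inr ⟨hv, hadj⟩⟩
  choose f hf using hf
  have hmem (c) : f c ∈ S ∪ M.vertsᶜ := by
    rcases hf c with h | h
    · exact .inr h.2
    · exact .inl h.1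
  have hinj : f.Injective := by
    intro c c' h
    suffices hww : w c.1 c.2 = w c'.1 c'.2 from
      Subtype.ext (ConnectedComponent.eq_of_common_vertex (hwc c.1 c.2) (hww ▸ hwc c'.1 c'.2))
    have hc := hf c
    have hc' := hf c'
    rw [← h] at hc'
    rcases hc with hc | hc <;> rcases hc' with hc' | hc'
    · exact Subtype.ext (hc.1.symm.trans hc'.1)
    · exact absurd hc'.1 (hc.1 ▸ (w c.1 c.2).2)
    · exact absurd hc.1 (hc'.1 ▸ (w c'.1 c'.2).2)
    · exact Subtype.ext (hM.eq_of_adj_right hc.2 hc'.2)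
  have hle : oddComp G S ≤ (S ∪ M.vertsᶜ).ncard :=
    Nat.card_le_card_of_injective (fun c ↦ (⟨f c, hmem c⟩ : ↥(S ∪ M.vertsᶜ)))
      fun c c' h ↦ hinj (congrArg Subtype.val h)
  have := Set.ncard_union_le S M.vertsᶜ
  have := Set.ncard_add_ncard_compl M.verts
  have := hM.two_mul_ncard_edgeSet
  lia

/-- The graph obtained from `G` by adding the vertices of `W`, each adjacent to every other
vertex. -/
def SimpleGraph.addUniversal {V : Type*} (G : SimpleGraph V) (W : Type*) :
    SimpleGraph (V ⊕ W) :=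
  (Gᶜ ⊕g (⊥ : SimpleGraph W))ᶜ

namespace SimpleGraph

variable {V W : Type*} {G : SimpleGraph V}

@[simp] lemma addUniversal_adj_inl_inl {u v : V} :
    (G.addUniversal W).Adj (.inl u) (.inl v) ↔ G.Adj u v := by
  have := G.ne_of_adj (a := u) (b := v)
  simp [addUniversal]
  tauto

lemma addUniversal_adj_inr {a : V ⊕ W} {w : W} (h : a ≠ .inr w) :
    (G.addUniversal W).Adj a (.inr w) := by
  cases a <;> simp_all [addUniversal]

lemma oddComp_addUniversal_of_range_inr_subset {U : Set (V ⊕ W)} (hU : Set.range .inr ⊆ U) :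
    oddComp (G.addUniversal W) U = oddComp G (Sum.inl ⁻¹' U) := by
  let e : ((Sum.inl ⁻¹' U)ᶜ : Set V) ≃ (Uᶜ : Set (V ⊕ W)) :=
    Equiv.ofBijective (fun v ↦ ⟨.inl v.1, v.2⟩) ⟨fun a b h ↦ by
      simpa [Subtype.ext_iff] using h, by
      rintro ⟨v | w, h⟩
      · exact ⟨⟨v, h⟩, rfl⟩
      · exact absurd (hU ⟨w, rfl⟩) h⟩
  let φ : G.induce (Sum.inl ⁻¹' U)ᶜ ≃g (G.addUniversal W).induce Uᶜ :=
    ⟨e, addUniversal_adj_inl_inl⟩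
  exact φ.ncard_oddComponents_eq.symm

lemma oddComp_addUniversal_le_one {U : Set (V ⊕ W)} {w : W} (hw : .inr w ∉ U) :
    oddComp (G.addUniversal W) U ≤ 1 := by
  have hreach (a : (Uᶜ : Set (V ⊕ W))) :
      ((G.addUniversal W).induce Uᶜ).Reachable a ⟨.inr w, hw⟩ := by
    by_cases h : a = ⟨.inr w, hw⟩
    · rw [h]
    · exact Adj.reachable (addUniversal_adj_inr fun h' ↦ h (Subtype.ext h'))
  have hpre : ((G.addUniversal W).induce Uᶜ).Preconnected :=
    fun a b ↦ (hreach a).trans (hreach b).symm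
  have := hpre.subsingleton_connectedComponent
  rw [oddComp_eq_ncard_oddComponents]
  exact Set.ncard_le_one_of_subsingleton _

lemma exists_isPerfectMatching_addUniversal [Finite V] [Finite W]
    (heven : Even (Nat.card V + Nat.card W))
    (h : ∀ S : Set V, oddComp G S ≤ S.ncard + Nat.card W) :
    ∃ N : (G.addUniversal W).Subgraph, N.IsPerfectMatching := by
  refine tutte.2 fun U ↦ ?_
  rw [isTutteViolator_iff_lt_oddComp, not_lt]
  by_cases hU : Set.range .inr ⊆ U
  · rw [oddComp_addUniversal_of_range_inr_subset hU]
    refine (h _).trans (le_of_eq ?_)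
    have hUeq : U = Sum.inl '' (Sum.inl ⁻¹' U) ∪ Set.range (Sum.inr : W → V ⊕ W) := by
      ext (v | w)
      · simp
      · simpa using hU ⟨w, rfl⟩
    conv_rhs => rw [hUeq]
    rw [Set.ncard_union_eq (by simp [Set.disjoint_left]),
      Set.ncard_image_of_injective _ Sum.inl_injective, ← Set.image_univ,
      Set.ncard_image_of_injective _ Sum.inr_injective, Set.ncard_univ]
  · obtain ⟨_, ⟨w, rfl⟩, hw⟩ := Set.not_subset.1 hU
    have hone := oddComp_addUniversal_le_one (G := G) hw
    rcases U.eq_empty_or_nonempty with rfl | hne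
    · have hodd := odd_oddComp_iff (G.addUniversal W) ∅
      rw [Set.compl_empty, Set.ncard_univ, Nat.card_sum, ← Nat.not_even_iff_odd (n := _ + _),
        iff_false_intro (not_not.2 heven), iff_false, Nat.not_odd_iff_even] at hodd
      obtain ⟨k, hk⟩ := hodd
      lia
    · exact hone.trans ((Set.ncard_pos).2 hne)

/-- A perfect matching of `G.addUniversal W` restricts to a matching of `G` that misses at most
`Nat.card W` vertices. -/
lemma Subgraph.IsPerfectMatching.exists_isMatching_of_addUniversal [Finite V] [Finite W]
    {N : (G.addUniversal W).Subgraph} (hN : N.IsPerfectMatching) :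
    ∃ M : G.Subgraph, M.IsMatching ∧ Nat.card V ≤ 2 * M.edgeSet.ncard + Nat.card W := by
  let M : G.Subgraph :=
    { verts := {v | ∃ w, N.Adj (.inl v) (.inl w)}
      Adj v w := N.Adj (.inl v) (.inl w)
      adj_sub h := addUniversal_adj_inl_inl.1 h.adj_sub
      edge_vert h := ⟨_, h⟩
      symm := ⟨fun _ _ h ↦ h.symm⟩ }
  have hM : M.IsMatching := fun v ⟨w, hw⟩ ↦
    ⟨w, hw, fun _ hy ↦ Sum.inl_injective (hN.1.eq_of_adj_left hy hw)⟩
  refine ⟨M, hM, ?_⟩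
  have hpartner (v : ↥M.vertsᶜ) : ∃ w : W, N.Adj (.inl v) (.inr w) := by
    obtain ⟨w | w, hw, -⟩ := hN.1 (hN.2 (.inl v))
    · exact absurd ⟨w, hw⟩ v.2
    · exact ⟨w, hw⟩
  choose f hf using hpartner
  have hle : M.vertsᶜ.ncard ≤ Nat.card W := Nat.card_le_card_of_injective f fun u v h ↦
    Subtype.ext (Sum.inl_injective (hN.1.eq_of_adj_right (hf u) (h ▸ hf v)))
  have := Set.ncard_add_ncard_compl M.verts
  have := hM.two_mul_ncard_edgeSet
  lia

/-- The **Tutte–Berge formula**: some matching and some vertex set attain equality in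
`Subgraph.IsMatching.oddComp_add_two_mul_ncard_edgeSet_le`. -/
theorem exists_isMatching_oddComp_add_two_mul_ncard_edgeSet_eq [Finite V] (G : SimpleGraph V) :
    ∃ (M : G.Subgraph) (S : Set V), M.IsMatching ∧
      oddComp G S + 2 * M.edgeSet.ncard = Nat.card V + S.ncard := by
  obtain ⟨S, hS⟩ := Finite.exists_max fun S : Set V ↦ (oddComp G S : ℤ) - S.ncard
  have hempty := hS ∅
  rw [Set.ncard_empty] at hempty
  obtain ⟨d, hd⟩ : ∃ d, oddComp G S = S.ncard + d := Nat.exists_eq_add_of_le (by lia)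
  have heven : Even (Nat.card V + Nat.card (Fin d)) := by
    have hpar := odd_oddComp_iff G S
    have hcard := Set.ncard_add_ncard_compl S
    rw [Nat.card_fin]
    grind
  obtain ⟨N, hN⟩ := exists_isPerfectMatching_addUniversal (G := G) heven fun T ↦ by
    have := hS T
    rw [Nat.card_fin]
    lia
  obtain ⟨M, hM, hle⟩ := hN.exists_isMatching_of_addUniversal
  have := hM.oddComp_add_two_mul_ncard_edgeSet_le S
  rw [Nat.card_fin] at hle
  exact ⟨M, S, hM, by lia⟩

end SimpleGraph

theorem stmt1 {V : Type*} [Fintype V] (G : SimpleGraph V) :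
    ∃ m : ℚ,
      IsGreatest {k : ℚ | ∃ M : G.Subgraph, M.IsMatching ∧ k = M.edgeSet.ncard} m ∧
      IsLeast {k : ℚ | ∃ S : Set V,
        k = ((Fintype.card V : ℚ) - ((oddComp G S : ℚ) - Nat.card S)) / 2} m := by
  obtain ⟨M, S, hM, hMS⟩ := exists_isMatching_oddComp_add_two_mul_ncard_edgeSet_eq G
  have hMSq : (oddComp G S + 2 * M.edgeSet.ncard : ℚ) = Nat.card V + S.ncard := by
    exact_mod_cast hMS
  simp only [Nat.card_coe_set_eq, ← Nat.card_eq_fintype_card]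
  refine ⟨M.edgeSet.ncard, ⟨⟨M, hM, rfl⟩, ?_⟩, ⟨S, by linarith⟩, ?_⟩
  · rintro _ ⟨M', hM', rfl⟩
    have := hM'.oddComp_add_two_mul_ncard_edgeSet_le S
    exact_mod_cast (by lia : M'.edgeSet.ncard ≤ M.edgeSet.ncard)
  · rintro _ ⟨T, rfl⟩
    have hMT : (oddComp G T + 2 * M.edgeSet.ncard : ℚ) ≤ Nat.card V + T.ncard := by
      exact_mod_cast hM.oddComp_add_two_mul_ncard_edgeSet_le T
    linarith
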